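/- arXiv:1606.06848 — 5 statements merged into one kernel-verified Lean document; each statement's English description precedes it below -/
import Mathlib

section
/- Let a, b > 0, 0 ≤ ν ≤ 1 and N ∈ ℕ. Then S_N(ν; a, b) = S_N(1−ν; b, a) and R_N(ν; a, b) = R_N(1−ν; b, a). -/
open Real Finset

noncomputable def kj (j : ℕ) (ν : ℝ) : ℤ := ⌊(2:ℝ)^(j-1) * ν⌋

noncomputable def rj (j : ℕ) (ν : ℝ) : ℤ := ⌊(2:ℝ)^j * ν⌋

noncomputable def sj (j : ℕ) (ν : ℝ) : ℝ :=
  (-1:ℝ)^(rj j ν) * (2:ℝ)^(j-1) * ν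
    + (-1:ℝ)^(rj j ν + 1) * (⌊((rj j ν : ℝ) + 1)/2⌋ : ℤ)

noncomputable def SS (N : ℕ) (ν a b : ℝ) : ℝ :=
  ∑ j ∈ Finset.Icc 1 N, sj j ν *
    ((b ^ ((2:ℝ)^(j-1) - (kj j ν : ℝ)) * a ^ ((kj j ν : ℝ))) ^ ((1:ℝ)/2^j)
      - (a ^ ((kj j ν : ℝ) + 1) * b ^ ((2:ℝ)^(j-1) - (kj j ν : ℝ) - 1)) ^ ((1:ℝ)/2^j))^2

noncomputable def RR (N : ℕ) (ν a b : ℝ) : ℝ :=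
  ((⌊(2:ℝ)^N * ν⌋ : ℝ) + 1 - (2:ℝ)^N * ν) *
      (a ^ ((⌊(2:ℝ)^N * ν⌋ : ℝ)) * b ^ ((2:ℝ)^N - (⌊(2:ℝ)^N * ν⌋ : ℝ))) ^ ((1:ℝ)/2^N)
    + ((2:ℝ)^N * ν - (⌊(2:ℝ)^N * ν⌋ : ℝ)) *
      (a ^ ((⌊(2:ℝ)^N * ν⌋ : ℝ) + 1) * b ^ ((2:ℝ)^N - (⌊(2:ℝ)^N * ν⌋ : ℝ) - 1)) ^ ((1:ℝ)/2^N)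

theorem floor_natCast_sub_cases (M : ℕ) (x : ℝ) :
    (x = ⌊x⌋ ∧ ⌊(M : ℝ) - x⌋ = M - ⌊x⌋) ∨ ⌊(M : ℝ) - x⌋ = M - ⌊x⌋ - 1 := by
  have hl := Int.floor_le x
  have hu := Int.lt_floor_add_one x
  rcases hl.eq_or_lt with h | h
  · left
    refine ⟨h.symm, ?_⟩
    rw [Int.floor_eq_iff]
    push_cast
    constructor <;> linarith
  · right
    rw [Int.floor_eq_iff]
    push_cast
    constructor <;> linarith

theorem sj_succ (n : ℕ) (ν : ℝ) :
    sj (n + 1) ν = min ((2 : ℝ) ^ n * ν - kj (n + 1) ν) (kj (n + 1) ν + 1 - (2 : ℝ) ^ n * ν) := by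
  have hx : (2 : ℝ) ^ (n + 1) * ν = 2 * ((2 : ℝ) ^ n * ν) := by ring
  simp only [sj, kj, rj, Nat.add_sub_cancel, hx, mul_assoc]
  generalize (2 : ℝ) ^ n * ν = x
  have hl := Int.floor_le x
  have hu := Int.lt_floor_add_one x
  generalize ⌊x⌋ = k at hl hu ⊢
  rcases lt_or_ge (2 * x) (2 * k + 1) with h | h
  · have hr : ⌊2 * x⌋ = 2 * k := by
      rw [Int.floor_eq_iff]
      push_cast
      constructor <;> linarith
    have hf : ⌊(((2 * k : ℤ) : ℝ) + 1) / 2⌋ = k := by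
      rw [Int.floor_eq_iff]
      push_cast
      constructor <;> linarith
    rw [hr, hf, (even_two_mul k).neg_one_zpow, (odd_two_mul_add_one k).neg_one_zpow,
      min_eq_left (by linarith)]
    ring
  · have hr : ⌊2 * x⌋ = 2 * k + 1 := by
      rw [Int.floor_eq_iff]
      push_cast
      constructor <;> linarith
    have hf : ⌊(((2 * k + 1 : ℤ) : ℝ) + 1) / 2⌋ = k + 1 := by
      rw [Int.floor_eq_iff]
      push_cast
      constructor <;> linarith
    rw [hr, hf, (odd_two_mul_add_one k).neg_one_zpow,
      (odd_two_mul_add_one k).add_one.neg_one_zpow, min_eq_right (by linarith)]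
    push_cast
    ring

theorem SS_eq_SS_one_sub (N : ℕ) (ν a b : ℝ) : SS N ν a b = SS N (1 - ν) b a := by
  refine Finset.sum_congr rfl fun j hj => ?_
  obtain ⟨n, rfl⟩ := Nat.exists_eq_add_of_le' (Finset.mem_Icc.mp hj).1
  rw [sj_succ, sj_succ]
  simp only [kj, Nat.add_sub_cancel, mul_sub, mul_one]
  have hM : ((2 ^ n : ℕ) : ℝ) = (2 : ℝ) ^ n := by push_cast; rfl
  have hc := floor_natCast_sub_cases (2 ^ n) ((2 : ℝ) ^ n * ν)
  rw [← hM] at hc ⊢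
  generalize 2 ^ n = M at hc ⊢
  generalize (M : ℝ) * ν = x at hc ⊢
  rcases hc with ⟨h, hk⟩ | hk
  · rw [hk]
    generalize ⌊x⌋ = k at h ⊢
    subst h
    simp
  · rw [hk]
    generalize ⌊x⌋ = k
    push_cast
    rw [show (M : ℝ) - x - (M - k - 1) = k + 1 - x by ring,
      show (M : ℝ) - k - 1 + 1 - (M - x) = x - k by ring,
      show (M : ℝ) - (M - k - 1) = k + 1 by ring,
      show (M : ℝ) - k - 1 + 1 = M - k by ring,
      show (k : ℝ) + 1 - 1 = k by ring, min_comm]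
    ring

theorem RR_eq_RR_one_sub (N : ℕ) (ν a b : ℝ) : RR N ν a b = RR N (1 - ν) b a := by
  simp only [RR, mul_sub, mul_one]
  generalize (1 : ℝ) / 2 ^ N = p
  have hM : ((2 ^ N : ℕ) : ℝ) = (2 : ℝ) ^ N := by push_cast; rfl
  have hc := floor_natCast_sub_cases (2 ^ N) ((2 : ℝ) ^ N * ν)
  rw [← hM] at hc ⊢
  generalize 2 ^ N = M at hc ⊢
  generalize (M : ℝ) * ν = x at hc ⊢
  rcases hc with ⟨h, hk⟩ | hk
  · rw [hk]
    generalize ⌊x⌋ = k at h ⊢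
    subst h
    simp [mul_comm]
  · rw [hk]
    generalize ⌊x⌋ = k
    push_cast
    rw [show (M : ℝ) - x - (M - k - 1) = k + 1 - x by ring,
      show (M : ℝ) - k - 1 + 1 - (M - x) = x - k by ring,
      show (M : ℝ) - (M - k - 1) = k + 1 by ring,
      show (M : ℝ) - k - 1 + 1 = M - k by ring,
      show (k : ℝ) + 1 - 1 = k by ring, mul_comm (b ^ _), mul_comm (b ^ _)]
    ring

theorem stmt0 (a b ν : ℝ) (ha : 0 < a) (hb : 0 < b) (h0 : 0 ≤ ν) (h1 : ν ≤ 1) (N : ℕ) :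
    SS N ν a b = SS N (1 - ν) b a ∧ RR N ν a b = RR N (1 - ν) b a := by
  exact ⟨SS_eq_SS_one_sub N ν a b, RR_eq_RR_one_sub N ν a b⟩
end

section
/- Let a, b > 0 and N ∈ ℕ. If 0 ≤ ν ≤ 1/2, then ν a + (1−ν) b + S_N(2ν; √(ab), a) ≤ a^ν b^{1−ν} + (1−ν)(√a − √b)². If 1/2 ≤ ν ≤ 1, then ν a + (1−ν) b + S_N(2−2ν; √(ab), b) ≤ a^ν b^{1−ν} + ν(√a − √b)². -/
open Real Finset

/-- The weighted geometric mean `a ^ x * b ^ (1 - x)`, in exponential form. -/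
noncomputable def geomInterp (a b x : ℝ) : ℝ := exp (x * log a + (1 - x) * log b)

/-- The piecewise linear interpolation of `geomInterp a b` at the dyadic points of level `n`. -/
noncomputable def dyadicInterp (a b : ℝ) (n : ℕ) (x : ℝ) : ℝ :=
  (1 - (2 ^ n * x - ⌊(2:ℝ) ^ n * x⌋)) * geomInterp a b (⌊(2:ℝ) ^ n * x⌋ / 2 ^ n)
    + (2 ^ n * x - ⌊(2:ℝ) ^ n * x⌋) * geomInterp a b ((⌊(2:ℝ) ^ n * x⌋ + 1) / 2 ^ n)

lemma geomInterp_eq {a b : ℝ} (ha : 0 < a) (hb : 0 < b) (x : ℝ) :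
    geomInterp a b x = a ^ x * b ^ (1 - x) := by
  rw [geomInterp, rpow_def_of_pos ha, rpow_def_of_pos hb, ← exp_add]
  ring_nf

lemma geomInterp_le_dyadicInterp (a b : ℝ) (n : ℕ) (x : ℝ) :
    geomInterp a b x ≤ dyadicInterp a b n x := by
  have h0 : 0 ≤ (2:ℝ) ^ n * x - ⌊(2:ℝ) ^ n * x⌋ := sub_nonneg.2 (Int.floor_le _)
  have h1 : 0 ≤ 1 - ((2:ℝ) ^ n * x - ⌊(2:ℝ) ^ n * x⌋) := by
    linarith [Int.lt_floor_add_one ((2:ℝ) ^ n * x)]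
  have h := convexOn_exp.2
    (Set.mem_univ ((⌊(2:ℝ) ^ n * x⌋ / 2 ^ n : ℝ) * log a + (1 - ⌊(2:ℝ) ^ n * x⌋ / 2 ^ n) * log b))
    (Set.mem_univ (((⌊(2:ℝ) ^ n * x⌋ + 1) / 2 ^ n : ℝ) * log a
      + (1 - (⌊(2:ℝ) ^ n * x⌋ + 1) / 2 ^ n) * log b)) h1 h0 (by ring)
  simp only [smul_eq_mul] at h
  unfold dyadicInterp geomInterp
  refine le_trans (le_of_eq ?_) h
  congr 1
  field_simp
  ring

lemma dyadicInterp_zero {a b x : ℝ} (ha : 0 < a) (hb : 0 < b) (h0 : 0 ≤ x) (h1 : x ≤ 1) :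
    dyadicInterp a b 0 x = x * a + (1 - x) * b := by
  rcases h1.eq_or_lt with rfl | h1
  · simp [dyadicInterp, geomInterp, exp_log ha]
  · have : ⌊x⌋ = 0 := Int.floor_eq_zero_iff.2 ⟨h0, h1⟩
    simp [dyadicInterp, geomInterp, exp_log ha, exp_log hb, this]
    ring

lemma sq_sub_eq_geomInterp {a b : ℝ} (ha : 0 < a) (hb : 0 < b) (n : ℕ) (k : ℝ) :
    ((b ^ ((2:ℝ) ^ n - k) * a ^ k) ^ ((1:ℝ) / 2 ^ (n + 1))
      - (a ^ (k + 1) * b ^ ((2:ℝ) ^ n - k - 1)) ^ ((1:ℝ) / 2 ^ (n + 1))) ^ 2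
    = geomInterp a b (k / 2 ^ n) + geomInterp a b ((k + 1) / 2 ^ n)
      - 2 * geomInterp a b ((2 * k + 1) / 2 ^ (n + 1)) := by
  rw [sub_sq]
  simp only [rpow_def_of_pos ha, rpow_def_of_pos hb, ← exp_add, ← exp_mul, geomInterp, mul_assoc,
    ← exp_nat_mul]
  have e1 : ((2:ℕ):ℝ) * ((log b * ((2:ℝ) ^ n - k) + log a * k) * (1 / 2 ^ (n + 1)))
      = k / 2 ^ n * log a + (1 - k / 2 ^ n) * log b := by
    push_cast; field_simp; ring
  have e2 : ((2:ℕ):ℝ) * ((log a * (k + 1) + log b * ((2:ℝ) ^ n - k - 1)) * (1 / 2 ^ (n + 1)))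
      = (k + 1) / 2 ^ n * log a + (1 - (k + 1) / 2 ^ n) * log b := by
    push_cast; field_simp; ring
  have e3 : (log b * ((2:ℝ) ^ n - k) + log a * k) * (1 / 2 ^ (n + 1))
      + (log a * (k + 1) + log b * ((2:ℝ) ^ n - k - 1)) * (1 / 2 ^ (n + 1))
      = (2 * k + 1) / 2 ^ (n + 1) * log a + (1 - (2 * k + 1) / 2 ^ (n + 1)) * log b := by
    field_simp; ring
  rw [e1, e2, e3]
  ring

lemma floor_two_mul_eq_or (y : ℝ) : ⌊2 * y⌋ = 2 * ⌊y⌋ ∨ ⌊2 * y⌋ = 2 * ⌊y⌋ + 1 := by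
  have h1 : 2 * ⌊y⌋ ≤ ⌊2 * y⌋ := Int.le_floor.2 (by push_cast; linarith [Int.floor_le y])
  have h2 : ⌊2 * y⌋ < 2 * ⌊y⌋ + 2 :=
    Int.floor_lt.2 (by push_cast; linarith [Int.lt_floor_add_one y])
  omega

lemma dyadicInterp_succ_add {a b : ℝ} (ha : 0 < a) (hb : 0 < b) (n : ℕ) (x : ℝ) :
    dyadicInterp a b (n + 1) x + sj (n + 1) x *
      ((b ^ ((2:ℝ) ^ n - (kj (n + 1) x : ℝ)) * a ^ (kj (n + 1) x : ℝ)) ^ ((1:ℝ) / 2 ^ (n + 1))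
        - (a ^ ((kj (n + 1) x : ℝ) + 1) * b ^ ((2:ℝ) ^ n - (kj (n + 1) x : ℝ) - 1))
          ^ ((1:ℝ) / 2 ^ (n + 1))) ^ 2
    = dyadicInterp a b n x := by
  rw [sq_sub_eq_geomInterp ha hb]
  have e : (2:ℝ) ^ (n + 1) * x = 2 * (2 ^ n * x) := by ring
  simp only [sj, rj, kj, dyadicInterp, Nat.add_sub_cancel, e]
  generalize hy : (2:ℝ) ^ n * x = y
  rcases floor_two_mul_eq_or y with h | h
  · have hf : ⌊((2 * ⌊y⌋ : ℤ) + 1 : ℝ) / 2⌋ = ⌊y⌋ := by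
      rw [Int.floor_eq_iff]; push_cast; constructor <;> linarith
    have hk : (2 * (⌊y⌋:ℝ)) / 2 ^ (n + 1) = ⌊y⌋ / 2 ^ n := by field_simp; ring
    rw [h, hf, (even_two_mul _).neg_one_zpow, (even_two_mul _).add_one.neg_one_zpow,
      mul_assoc, hy]
    push_cast
    rw [hk]
    ring
  · have hf : ⌊((2 * ⌊y⌋ + 1 : ℤ) + 1 : ℝ) / 2⌋ = ⌊y⌋ + 1 := by
      rw [Int.floor_eq_iff]; push_cast; constructor <;> linarith
    have hk : (2 * (⌊y⌋:ℝ) + 1 + 1) / 2 ^ (n + 1) = (⌊y⌋ + 1) / 2 ^ n := by field_simp; ring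
    rw [h, hf, (even_two_mul _).add_one.neg_one_zpow,
      (even_two_mul _).add_one.add_one.neg_one_zpow, mul_assoc, hy]
    push_cast
    rw [hk]
    ring

lemma dyadicInterp_add_SS {a b : ℝ} (ha : 0 < a) (hb : 0 < b) (x : ℝ) (N : ℕ) :
    dyadicInterp a b N x + SS N x a b = dyadicInterp a b 0 x := by
  induction N with
  | zero => simp [SS]
  | succ n ih =>
    rw [← ih, ← dyadicInterp_succ_add ha hb n x, SS, SS,
      Finset.sum_Icc_succ_top (Nat.le_add_left 1 n)]
    simp only [Nat.add_sub_cancel]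
    ring

/-- The refined Young inequality. -/
lemma rpow_mul_rpow_add_SS_le {a b x : ℝ} (ha : 0 < a) (hb : 0 < b) (h0 : 0 ≤ x) (h1 : x ≤ 1)
    (N : ℕ) : a ^ x * b ^ (1 - x) + SS N x a b ≤ x * a + (1 - x) * b := by
  rw [← dyadicInterp_zero ha hb h0 h1, ← dyadicInterp_add_SS ha hb x N, ← geomInterp_eq ha hb]
  gcongr
  exact geomInterp_le_dyadicInterp a b N x

lemma two_mul_sqrt_le_heinz {a b : ℝ} (ha : 0 < a) (hb : 0 < b) (x : ℝ) :
    2 * √(a * b) ≤ a ^ x * b ^ (1 - x) + a ^ (1 - x) * b ^ x := by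
  have h : (a ^ x * b ^ (1 - x)) * (a ^ (1 - x) * b ^ x) = a * b := by
    calc _ = (a ^ x * a ^ (1 - x)) * (b ^ (1 - x) * b ^ x) := by ring
      _ = a * b := by rw [← rpow_add ha, ← rpow_add hb]; simp
  have hp : 0 ≤ a ^ x * b ^ (1 - x) := by positivity
  have hq : 0 ≤ a ^ (1 - x) * b ^ x := by positivity
  rw [← h, sqrt_mul hp]
  nlinarith [sq_nonneg (√(a ^ x * b ^ (1 - x)) - √(a ^ (1 - x) * b ^ x)), sq_sqrt hp, sq_sqrt hq]

lemma reversed_young_of_le_half {a b x : ℝ} (ha : 0 < a) (hb : 0 < b) (N : ℕ) (h0 : 0 ≤ x)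
    (h1 : x ≤ 1 / 2) :
    x * a + (1 - x) * b + SS N (2 * x) (√(a * b)) a
      ≤ a ^ x * b ^ (1 - x) + (1 - x) * (√a - √b) ^ 2 := by
  have hc : 0 < √(a * b) := by positivity
  have hy := rpow_mul_rpow_add_SS_le hc ha (x := 2 * x) (by linarith) (by linarith) N
  have he : √(a * b) ^ (2 * x) * a ^ (1 - 2 * x) = a ^ (1 - x) * b ^ x := by
    rw [rpow_mul hc.le, rpow_two, sq_sqrt (by positivity), mul_rpow ha.le hb.le, mul_right_comm,
      ← rpow_add ha]
    ring_nf
  have hs : (√a - √b) ^ 2 = a + b - 2 * √(a * b) := by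
    rw [sqrt_mul ha.le, sub_sq, sq_sqrt ha.le, sq_sqrt hb.le]; ring
  rw [he] at hy
  rw [hs]
  linarith [two_mul_sqrt_le_heinz ha hb x]

theorem stmt1 (a b ν : ℝ) (ha : 0 < a) (hb : 0 < b) (N : ℕ) :
    (0 ≤ ν → ν ≤ 1/2 →
      ν * a + (1 - ν) * b + SS N (2 * ν) (Real.sqrt (a * b)) a
        ≤ a ^ ν * b ^ (1 - ν) + (1 - ν) * (Real.sqrt a - Real.sqrt b)^2) ∧
    (1/2 ≤ ν → ν ≤ 1 →
      ν * a + (1 - ν) * b + SS N (2 - 2 * ν) (Real.sqrt (a * b)) b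
        ≤ a ^ ν * b ^ (1 - ν) + ν * (Real.sqrt a - Real.sqrt b)^2) := by
  refine ⟨fun h0 h1 => reversed_young_of_le_half ha hb N h0 h1, fun h0 h1 => ?_⟩
  have h := reversed_young_of_le_half hb ha N (x := 1 - ν) (by linarith) (by linarith)
  rw [mul_comm b a, sub_sub_cancel, show 2 * (1 - ν) = 2 - 2 * ν by ring] at h
  linarith [sub_sq_comm (√a) (√b)]
end

section
/- Let a, b > 0 and ν ≥ 0. Then for each N ∈ ℕ, (1+ν)a − νb + ν ∑_{j=1}^{N} 2^{j−1} ( √a − (a^{2^{j−1}−1} b)^{1/2^{j}} )² ≤ a^{1+ν} b^{−ν}. -/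
open Real Finset

theorem sqrt_sub_rpow_exp_sq (s t : ℝ) (n : ℕ) :
    (√(exp s) - (exp s ^ ((2:ℝ) ^ n - 1) * exp t) ^ ((1:ℝ) / 2 ^ (n + 1))) ^ 2
      = exp s * (1 - exp ((t - s) / 2 ^ (n + 1))) ^ 2 := by
  have h : (exp s ^ ((2:ℝ) ^ n - 1) * exp t) ^ ((1:ℝ) / 2 ^ (n + 1))
      = exp (s / 2) * exp ((t - s) / 2 ^ (n + 1)) := by
    rw [← exp_mul, ← exp_add, ← exp_mul, ← exp_add]
    congr 1
    field_simp
    ring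
  have hs : exp s = exp (s / 2) ^ 2 := by
    rw [← exp_nat_mul]
    congr 1
    push_cast
    ring
  rw [h, ← exp_half, hs]
  ring

theorem sum_sqrt_sub_rpow_exp_sq (s t : ℝ) (N : ℕ) :
    ∑ j ∈ Finset.Icc 1 N,
        (2:ℝ) ^ (j - 1)
          * (√(exp s) - (exp s ^ ((2:ℝ) ^ (j - 1) - 1) * exp t) ^ ((1:ℝ) / 2 ^ j)) ^ 2
      = exp t - exp s + 2 ^ N * exp s * (1 - exp ((t - s) / 2 ^ N)) := by
  induction N with
  | zero =>
    have h : exp t = exp s * exp (t - s) := by rw [← exp_add]; ring_nf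
    simp [h]
    ring
  | succ n ih =>
    have h : exp ((t - s) / 2 ^ n) = exp ((t - s) / 2 ^ (n + 1)) ^ 2 := by
      rw [← exp_nat_mul]
      congr 1
      push_cast
      field_simp
      ring
    rw [Finset.sum_Icc_succ_top (by omega), ih, Nat.add_sub_cancel, sqrt_sub_rpow_exp_sq, h]
    ring

theorem stmt2 (a b ν : ℝ) (ha : 0 < a) (hb : 0 < b) (hν : 0 ≤ ν) (N : ℕ) :
    (1 + ν) * a - ν * b
      + ν * ∑ j ∈ Finset.Icc 1 N,
          (2:ℝ)^(j-1) * (Real.sqrt a - (a ^ ((2:ℝ)^(j-1) - 1) * b) ^ ((1:ℝ)/2^j))^2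
      ≤ a ^ (1 + ν) * b ^ (-ν) := by
  obtain ⟨s, rfl⟩ : ∃ s, exp s = a := ⟨log a, exp_log ha⟩
  obtain ⟨t, rfl⟩ : ∃ t, exp t = b := ⟨log b, exp_log hb⟩
  rw [sum_sqrt_sub_rpow_exp_sq]
  have hR : exp s ^ (1 + ν) * exp t ^ (-ν) = exp s * exp (ν * (s - t)) := by
    rw [← exp_mul, ← exp_mul, ← exp_add, ← exp_add]
    ring_nf
  have h_log : (2:ℝ) ^ N * (1 - exp ((t - s) / 2 ^ N)) ≤ s - t := by
    have h := mul_le_mul_of_nonneg_left (add_one_le_exp ((t - s) / 2 ^ N))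
      (by positivity : (0:ℝ) ≤ 2 ^ N)
    rw [mul_add, mul_div_cancel₀ _ (by positivity)] at h
    linarith
  calc _ = exp s * (ν * (2 ^ N * (1 - exp ((t - s) / 2 ^ N))) + 1) := by ring
    _ ≤ exp s * (ν * (s - t) + 1) := by gcongr
    _ ≤ exp s * exp (ν * (s - t)) := by gcongr; exact add_one_le_exp _
    _ = _ := hR.symm
end

section
/- Let a, b > 0 and ν ≥ 0. Then for each N ∈ ℕ, (1+ν)a − νb + ν ∑_{j=1}^{N} 2^{j−1} ( √a − (a^{2^{j−1}−1} b)^{1/2^{j}} )² = (1 + 2^{N}ν) a − 2^{N} ν (a^{2^{N}−1} b)^{1/2^{N}}. -/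
open Real Finset

lemma sq_rpow_one_div_two_pow_succ {x : ℝ} (hx : 0 ≤ x) (n : ℕ) :
    (x ^ ((1:ℝ) / 2 ^ (n + 1))) ^ 2 = x ^ ((1:ℝ) / 2 ^ n) := by
  rw [← Real.rpow_natCast, ← Real.rpow_mul hx]
  congr 1
  push_cast
  field_simp
  ring

lemma sqrt_mul_rpow_one_div_two_pow_succ {a b : ℝ} (ha : 0 < a) (hb : 0 ≤ b) (n : ℕ) :
    √a * (a ^ ((2:ℝ) ^ n - 1) * b) ^ ((1:ℝ) / 2 ^ (n + 1))
      = (a ^ ((2:ℝ) ^ (n + 1) - 1) * b) ^ ((1:ℝ) / 2 ^ (n + 1)) := by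
  rw [Real.mul_rpow (by positivity) hb, Real.mul_rpow (by positivity) hb, ← mul_assoc,
    ← Real.rpow_mul ha.le, ← Real.rpow_mul ha.le, Real.sqrt_eq_rpow, ← Real.rpow_add ha]
  congr 2
  field_simp
  ring

theorem stmt3 (a b ν : ℝ) (ha : 0 < a) (hb : 0 < b) (hν : 0 ≤ ν) (N : ℕ) :
    (1 + ν) * a - ν * b
      + ν * ∑ j ∈ Finset.Icc 1 N,
          (2:ℝ)^(j-1) * (Real.sqrt a - (a ^ ((2:ℝ)^(j-1) - 1) * b) ^ ((1:ℝ)/2^j))^2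
      = (1 + (2:ℝ)^N * ν) * a - (2:ℝ)^N * ν * (a ^ ((2:ℝ)^N - 1) * b) ^ ((1:ℝ)/2^N) := by
  induction N with
  | zero => simp
  | succ n ih =>
    rw [Finset.sum_Icc_succ_top (by omega), mul_add, ← add_assoc, ih, Nat.add_sub_cancel, sub_sq,
      Real.sq_sqrt ha.le, mul_assoc 2, sqrt_mul_rpow_one_div_two_pow_succ ha hb.le,
      sq_rpow_one_div_two_pow_succ (by positivity)]
    ring
end

section
/- Let a, b > 0, N, M ∈ ℕ with N ≥ 2, and 0 ≤ ν ≤ 1. Set α = ⌊2^{N}ν⌋ + 1 − 2^{N}ν, x = (a^{2⌊2^{N}ν⌋} b^{2^{N+1}−2⌊2^{N}ν⌋})^{1/2^{N}} and y = (a^{2⌊2^{N}ν⌋+2} b^{2^{N+1}−2⌊2^{N}ν⌋−2})^{1/2^{N}}. Then (a^ν b^{1−ν})² + s_1(ν)² (a−b)² + S_M(α; x, y) + ∑_{j=2}^{N} s_j(ν) ( (b^{2^{j−1}−k_j(ν)} a^{k_j(ν)})^{1/2^{j−1}} − (a^{k_j(ν)+1} b^{2^{j−1}−k_j(ν)−1})^{1/2^{j−1}}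 )² ≤ (ν a + (1−ν) b)². -/
open Real Finset

lemma kj_succ (N : ℕ) (ν : ℝ) : kj (N + 1) ν = ⌊(2:ℝ)^N * ν⌋ := by
  simp [kj]

/-- The factor `s_{N+1}(ν)` is `x - ⌊x⌋` or `⌊x⌋ + 1 - x` for `x = 2^N ν`, according to the parity
of `⌊2 x⌋`. -/
lemma floor_sj_cases (N : ℕ) (ν : ℝ) :
    (⌊(2:ℝ)^(N+1) * ν⌋ = 2 * ⌊(2:ℝ)^N * ν⌋ ∧
        sj (N + 1) ν = (2:ℝ)^N * ν - (⌊(2:ℝ)^N * ν⌋ : ℝ)) ∨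
      (⌊(2:ℝ)^(N+1) * ν⌋ = 2 * ⌊(2:ℝ)^N * ν⌋ + 1 ∧
        sj (N + 1) ν = (⌊(2:ℝ)^N * ν⌋ : ℝ) + 1 - (2:ℝ)^N * ν) := by
  have hx : (2:ℝ)^(N+1) * ν = 2 * ((2:ℝ)^N * ν) := by ring
  have hlo := Int.floor_le ((2:ℝ)^N * ν)
  have hhi := Int.lt_floor_add_one ((2:ℝ)^N * ν)
  simp only [sj, rj, Nat.add_sub_cancel, mul_assoc, hx]
  generalize (2:ℝ)^N * ν = x at *
  generalize ⌊x⌋ = n at *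
  by_cases h : 2 * x < 2 * n + 1
  · have hr : ⌊2 * x⌋ = 2 * n := by
      rw [Int.floor_eq_iff]; push_cast; constructor <;> linarith
    have hf : ⌊(((2 * n : ℤ) : ℝ) + 1) / 2⌋ = n := by
      rw [Int.floor_eq_iff]; push_cast; constructor <;> linarith
    have he : (-1:ℝ)^(2 * n) = 1 := (even_two_mul n).neg_one_zpow
    have ho : (-1:ℝ)^(2 * n + 1) = -1 := Odd.neg_one_zpow ⟨n, rfl⟩
    left
    rw [hr, hf, he, ho]
    exact ⟨rfl, by ring⟩
  · have hr : ⌊2 * x⌋ = 2 * n + 1 := by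
      rw [Int.floor_eq_iff]; push_cast; constructor <;> linarith
    have hf : ⌊(((2 * n + 1 : ℤ) : ℝ) + 1) / 2⌋ = n + 1 := by
      rw [Int.floor_eq_iff]; push_cast; constructor <;> linarith
    have ho : (-1:ℝ)^(2 * n + 1) = -1 := Odd.neg_one_zpow ⟨n, rfl⟩
    have he : (-1:ℝ)^(2 * n + 1 + 1) = 1 := Even.neg_one_zpow ⟨n + 1, by ring⟩
    right
    rw [hr, hf, he, ho]
    exact ⟨rfl, by push_cast; ring⟩

/-- Subtracting `S_N` from the weighted arithmetic mean leaves the piecewise linear interpolation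
of the weighted geometric mean `t ↦ exp (t p + (1 - t) q)` at the dyadic points `n / 2^N`. -/
lemma weighted_mean_eq_SS_add (N : ℕ) (ν p q : ℝ) (h0 : 0 ≤ ν) (h1 : ν ≤ 1) :
    ν * exp p + (1 - ν) * exp q = SS N ν (exp p) (exp q)
      + (((⌊(2:ℝ)^N * ν⌋ : ℝ) + 1 - (2:ℝ)^N * ν)
          * exp (q + (⌊(2:ℝ)^N * ν⌋ : ℝ) / 2^N * (p - q))
        + ((2:ℝ)^N * ν - (⌊(2:ℝ)^N * ν⌋ : ℝ))
          * exp (q + ((⌊(2:ℝ)^N * ν⌋ : ℝ) + 1) / 2^N * (p - q))) := by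
  induction N with
  | zero =>
    rcases h1.lt_or_eq with h | rfl
    · have : ⌊ν⌋ = 0 := Int.floor_eq_zero_iff.2 ⟨h0, h⟩
      simp [SS, this]; ring
    · simp [SS]
  | succ N ih =>
    rw [ih]
    have hS : SS (N + 1) ν (exp p) (exp q) = SS N ν (exp p) (exp q) + sj (N + 1) ν *
        (exp ((q + (⌊(2:ℝ)^N * ν⌋ : ℝ) / 2^N * (p - q)) / 2)
          - exp ((q + ((⌊(2:ℝ)^N * ν⌋ : ℝ) + 1) / 2^N * (p - q)) / 2)) ^ 2 := by
      unfold SS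
      rw [Finset.sum_Icc_succ_top (by omega)]
      simp only [kj_succ, Nat.add_sub_cancel, ← Real.exp_mul, ← Real.exp_add]
      congr 4 <;> congr 1 <;> rw [pow_succ] <;> field_simp <;> ring
    rw [hS]
    have hsq (u : ℝ) : exp u = exp (u / 2) ^ 2 := by
      rw [← Real.exp_nat_mul]; congr 1; push_cast; ring
    have hmid : exp (q + (2 * (⌊(2:ℝ)^N * ν⌋ : ℝ) + 1) / 2^(N+1) * (p - q))
        = exp ((q + (⌊(2:ℝ)^N * ν⌋ : ℝ) / 2^N * (p - q)) / 2)
          * exp ((q + ((⌊(2:ℝ)^N * ν⌋ : ℝ) + 1) / 2^N * (p - q)) / 2) := by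
      rw [← Real.exp_add]; congr 1; rw [pow_succ]; field_simp; ring
    have hpow : (2:ℝ)^(N+1) * ν = 2 * ((2:ℝ)^N * ν) := by ring
    have hdiv (t : ℝ) : 2 * t / 2^(N+1) = t / 2^N := by rw [pow_succ]; field_simp
    rcases floor_sj_cases N ν with ⟨hr, hs⟩ | ⟨hr, hs⟩
    · rw [hr, hs, hpow]
      push_cast
      rw [hmid, hdiv, hsq (q + (⌊(2:ℝ)^N * ν⌋ : ℝ) / 2^N * (p - q)),
        hsq (q + ((⌊(2:ℝ)^N * ν⌋ : ℝ) + 1) / 2^N * (p - q))]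
      ring
    · rw [hr, hs, hpow]
      push_cast
      have hend : 2 * (⌊(2:ℝ)^N * ν⌋ : ℝ) + 1 + 1 = 2 * ((⌊(2:ℝ)^N * ν⌋ : ℝ) + 1) := by ring
      rw [hmid, hend, hdiv, hsq (q + (⌊(2:ℝ)^N * ν⌋ : ℝ) / 2^N * (p - q)),
        hsq (q + ((⌊(2:ℝ)^N * ν⌋ : ℝ) + 1) / 2^N * (p - q))]
      ring

lemma exp_combo_le {s : ℝ} (u v : ℝ) (h0 : 0 ≤ s) (h1 : s ≤ 1) :
    exp (s * u + (1 - s) * v) ≤ s * exp u + (1 - s) * exp v :=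
  convexOn_exp.2 (Set.mem_univ u) (Set.mem_univ v) h0 (sub_nonneg.2 h1) (by ring)

/-- The refined Young inequality in exponential form. -/
lemma SS_add_exp_le (M : ℕ) (ν p q : ℝ) (h0 : 0 ≤ ν) (h1 : ν ≤ 1) :
    SS M ν (exp p) (exp q) + exp (ν * p + (1 - ν) * q) ≤ ν * exp p + (1 - ν) * exp q := by
  rw [weighted_mean_eq_SS_add M ν p q h0 h1]
  have hlo := Int.floor_le ((2:ℝ)^M * ν)
  have hhi := Int.lt_floor_add_one ((2:ℝ)^M * ν)
  have h := exp_combo_le (s := (⌊(2:ℝ)^M * ν⌋ : ℝ) + 1 - (2:ℝ)^M * ν)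
    (q + (⌊(2:ℝ)^M * ν⌋ : ℝ) / 2^M * (p - q))
    (q + ((⌊(2:ℝ)^M * ν⌋ : ℝ) + 1) / 2^M * (p - q)) (by linarith) (by linarith)
  have harg : ((⌊(2:ℝ)^M * ν⌋ : ℝ) + 1 - (2:ℝ)^M * ν)
        * (q + (⌊(2:ℝ)^M * ν⌋ : ℝ) / 2^M * (p - q))
      + (1 - ((⌊(2:ℝ)^M * ν⌋ : ℝ) + 1 - (2:ℝ)^M * ν))
        * (q + ((⌊(2:ℝ)^M * ν⌋ : ℝ) + 1) / 2^M * (p - q)) = ν * p + (1 - ν) * q := by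
    field_simp; ring
  rw [harg] at h
  linarith

lemma sj_one_mul_one_sub (ν : ℝ) (h0 : 0 ≤ ν) (h1 : ν ≤ 1) :
    sj 1 ν * (1 - sj 1 ν) = ν * (1 - ν) := by
  have h := floor_sj_cases 0 ν
  simp only [zero_add, pow_zero, one_mul] at h
  rcases h1.lt_or_eq with hlt | rfl
  · rw [Int.floor_eq_zero_iff.2 ⟨h0, hlt⟩] at h
    rcases h with ⟨-, h⟩ | ⟨-, h⟩ <;> rw [h] <;> push_cast <;> ring
  · rw [Int.floor_one] at h
    rcases h with ⟨-, h⟩ | ⟨-, h⟩ <;> rw [h] <;> push_cast <;> ring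

/-- The sum `S_N(ν; a², b²)` with its first term split off. -/
lemma SS_exp_two_mul (N : ℕ) (hN : 1 ≤ N) (ν p q : ℝ) (h0 : 0 ≤ ν) (h1 : ν ≤ 1) :
    SS N ν (exp (2 * p)) (exp (2 * q)) = sj 1 ν * (exp p - exp q)^2
      + ∑ j ∈ Finset.Icc 2 N, sj j ν *
          ((exp q ^ ((2:ℝ)^(j-1) - (kj j ν : ℝ)) * exp p ^ ((kj j ν : ℝ))) ^ ((1:ℝ)/2^(j-1))
            - (exp p ^ ((kj j ν : ℝ) + 1)
              * exp q ^ ((2:ℝ)^(j-1) - (kj j ν : ℝ) - 1)) ^ ((1:ℝ)/2^(j-1)))^2 := by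
  unfold SS
  rw [← Finset.add_sum_Ioc_eq_sum_Icc hN]
  congr 1
  · have hk : kj 1 ν = ⌊ν⌋ := by simp [kj]
    have hj := floor_sj_cases 0 ν
    simp only [← Real.exp_mul, ← Real.exp_add, hk]
    rcases h1.lt_or_eq with hlt | rfl
    · rw [Int.floor_eq_zero_iff.2 ⟨h0, hlt⟩]
      norm_num
      left
      ring_nf
    · have : sj 1 1 = 0 := by
        rcases hj with ⟨-, h⟩ | ⟨h, -⟩
        · simpa using h
        · norm_num at h
      simp [this]
  · refine Finset.sum_congr (by ext; simp; omega) fun j hj => ?_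
    obtain ⟨i, rfl⟩ : ∃ i, j = i + 1 := ⟨j - 1, by simp at hj; omega⟩
    simp only [Nat.add_sub_cancel, ← Real.exp_mul, ← Real.exp_add]
    congr 4 <;> rw [pow_succ] <;> field_simp

theorem stmt9 (a b ν : ℝ) (ha : 0 < a) (hb : 0 < b) (N M : ℕ) (hN : 2 ≤ N)
    (h0 : 0 ≤ ν) (h1 : ν ≤ 1) :
    (a ^ ν * b ^ (1 - ν))^2 + (sj 1 ν)^2 * (a - b)^2
      + SS M ((⌊(2:ℝ)^N * ν⌋ : ℝ) + 1 - (2:ℝ)^N * ν)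
          ((a ^ (2 * (⌊(2:ℝ)^N * ν⌋ : ℝ))
              * b ^ ((2:ℝ)^(N+1) - 2 * (⌊(2:ℝ)^N * ν⌋ : ℝ))) ^ ((1:ℝ)/2^N))
          ((a ^ (2 * (⌊(2:ℝ)^N * ν⌋ : ℝ) + 2)
              * b ^ ((2:ℝ)^(N+1) - 2 * (⌊(2:ℝ)^N * ν⌋ : ℝ) - 2)) ^ ((1:ℝ)/2^N))
      + ∑ j ∈ Finset.Icc 2 N, sj j ν *
          ((b ^ ((2:ℝ)^(j-1) - (kj j ν : ℝ)) * a ^ ((kj j ν : ℝ))) ^ ((1:ℝ)/2^(j-1))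
            - (a ^ ((kj j ν : ℝ) + 1) * b ^ ((2:ℝ)^(j-1) - (kj j ν : ℝ) - 1)) ^ ((1:ℝ)/2^(j-1)))^2
      ≤ (ν * a + (1 - ν) * b)^2 := by
  obtain ⟨p, rfl⟩ : ∃ p, exp p = a := ⟨log a, exp_log ha⟩
  obtain ⟨q, rfl⟩ : ∃ q, exp q = b := ⟨log b, exp_log hb⟩
  have hsum := SS_exp_two_mul N (by omega) ν p q h0 h1
  have hW := weighted_mean_eq_SS_add N ν (2 * p) (2 * q) h0 h1
  have hlo := Int.floor_le ((2:ℝ)^N * ν)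
  have hhi := Int.lt_floor_add_one ((2:ℝ)^N * ν)
  have hx : (exp p ^ (2 * (⌊(2:ℝ)^N * ν⌋ : ℝ))
      * exp q ^ ((2:ℝ)^(N+1) - 2 * (⌊(2:ℝ)^N * ν⌋ : ℝ))) ^ ((1:ℝ)/2^N)
      = exp (2 * q + (⌊(2:ℝ)^N * ν⌋ : ℝ) / 2^N * (2 * p - 2 * q)) := by
    simp only [← Real.exp_mul, ← Real.exp_add]
    congr 1; rw [pow_succ]; field_simp; ring
  have hy : (exp p ^ (2 * (⌊(2:ℝ)^N * ν⌋ : ℝ) + 2)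
      * exp q ^ ((2:ℝ)^(N+1) - 2 * (⌊(2:ℝ)^N * ν⌋ : ℝ) - 2)) ^ ((1:ℝ)/2^N)
      = exp (2 * q + ((⌊(2:ℝ)^N * ν⌋ : ℝ) + 1) / 2^N * (2 * p - 2 * q)) := by
    simp only [← Real.exp_mul, ← Real.exp_add]
    congr 1; rw [pow_succ]; field_simp; ring
  have hmean : (exp p ^ ν * exp q ^ (1 - ν))^2
      = exp (((⌊(2:ℝ)^N * ν⌋ : ℝ) + 1 - (2:ℝ)^N * ν)
        * (2 * q + (⌊(2:ℝ)^N * ν⌋ : ℝ) / 2^N * (2 * p - 2 * q))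
      + (1 - ((⌊(2:ℝ)^N * ν⌋ : ℝ) + 1 - (2:ℝ)^N * ν))
        * (2 * q + ((⌊(2:ℝ)^N * ν⌋ : ℝ) + 1) / 2^N * (2 * p - 2 * q))) := by
    simp only [← Real.exp_mul, ← Real.exp_add, ← Real.exp_nat_mul]
    congr 1; push_cast; field_simp; ring
  have hY := SS_add_exp_le M ((⌊(2:ℝ)^N * ν⌋ : ℝ) + 1 - (2:ℝ)^N * ν)
    (2 * q + (⌊(2:ℝ)^N * ν⌋ : ℝ) / 2^N * (2 * p - 2 * q))
    (2 * q + ((⌊(2:ℝ)^N * ν⌋ : ℝ) + 1) / 2^N * (2 * p - 2 * q)) (by linarith) (by linarith)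
  rw [hx, hy, hmean]
  have hsq (u : ℝ) : exp (2 * u) = exp u ^ 2 := by
    rw [← Real.exp_nat_mul]; norm_num
  have hcomplete : (ν * exp p + (1 - ν) * exp q)^2 = ν * exp (2 * p) + (1 - ν) * exp (2 * q)
      - sj 1 ν * (exp p - exp q)^2 + (sj 1 ν)^2 * (exp p - exp q)^2 := by
    rw [hsq, hsq]
    linear_combination (exp p - exp q)^2 * sj_one_mul_one_sub ν h0 h1
  linarith
end
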